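/- arXiv:1506.02831 — 2 statements merged into one kernel-verified Lean document; each statement's English description precedes it below -/
import Mathlib

section
/- Let Ω⁺ ⊂ ℝ³ be a bounded open set with |Ω⁺| = m > 0 and let λ > 0. Then the relaxed minimization problem min{ 𝓔(u) : u ∈ L¹(ℝ³; [0,1]), u = 0 a.e. on Ω⁺, ∫_{ℝ³} u ≤ λ } admits a minimizer, and the minimizer is unique up to equality almost everywhere. -/
open MeasureTheory Real Filter

noncomputable section

abbrev E3 := EuclideanSpace ℝ (Fin 3)

/-- The Coulomb kernel in ℝ³. -/
def coul (x y : E3) : ℝ := 1 / (4 * π * ‖x - y‖)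

/-- The potential generated by the charge density `χ_{Ω⁺} − u`. -/
def potentialU (Ωp : Set E3) (u : E3 → ℝ) (x : E3) : ℝ :=
  ∫ y, (Set.indicator Ωp (fun _ => (1:ℝ)) y - u y) * coul x y

/-- The relaxed Coulomb energy
`𝓔(u) = ∫∫ (χ_{Ω⁺}−u)(x) (χ_{Ω⁺}−u)(y) / (4π|x−y|) dx dy`. -/
def relEnergy (Ωp : Set E3) (u : E3 → ℝ) : ℝ :=
  ∫ x, ∫ y, (Set.indicator Ωp (fun _ => (1:ℝ)) x - u x) *
    ((Set.indicator Ωp (fun _ => (1:ℝ)) y - u y) * coul x y)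

/-- Admissible relaxed densities: `u ∈ L¹(ℝ³;[0,1])`, `u = 0` a.e. on `Ω⁺`,
`∫ u ≤ λ`. -/
def RelAdm (Ωp : Set E3) (lam : ℝ) (u : E3 → ℝ) : Prop :=
  Integrable u ∧ (∀ᵐ x, 0 ≤ u x ∧ u x ≤ 1) ∧ (∀ᵐ x, x ∈ Ωp → u x = 0) ∧
    ∫ x, u x ≤ lam

section BallRepresentation

open Metric Set Topology
open scoped ENNReal

/-- The measure `r⁻⁵ dr` on the positive half-line. -/
def radiusMeasure : Measure ℝ :=
  volume.withDensity fun r => ENNReal.ofReal ((r ^ 5)⁻¹)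

instance : SFinite radiusMeasure := by unfold radiusMeasure; infer_instance

/-- The measure `r⁻⁵ dz dr` on the space of balls, parametrized by centre and radius. -/
def ballMeasure : Measure (E3 × ℝ) := (volume : Measure E3).prod radiusMeasure

instance : SFinite ballMeasure := by unfold ballMeasure; infer_instance

/-- A reference unit vector. -/
def unitE3 : E3 := EuclideanSpace.single 0 1

lemma norm_unitE3 : ‖unitE3‖ = 1 := by simp [unitE3]

/-- The volume of the intersection of two balls of radius `s` with centres at distance one. -/
def lensVol (s : ℝ) : ℝ≥0∞ := volume (closedBall (0 : E3) s ∩ closedBall unitE3 s)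

/-- The total weight of the balls containing two given points at distance one. -/
def kernelConst : ℝ≥0∞ := ∫⁻ s, lensVol s ∂radiusMeasure

lemma lintegral_radiusMeasure (f : ℝ → ℝ≥0∞) :
    ∫⁻ r, f r ∂radiusMeasure = ∫⁻ r, ENNReal.ofReal ((r ^ 5)⁻¹) * f r := by
  unfold radiusMeasure
  rw [lintegral_withDensity_eq_lintegral_mul_non_measurable₀]
  · rfl
  · exact Measurable.aemeasurable (by fun_prop)
  · exact ae_of_all _ fun _ => ENNReal.ofReal_lt_top

lemma volume_inter_closedBall {x y : E3} (h : x ≠ y) (s : ℝ) :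
    volume (closedBall x (‖x - y‖ * s) ∩ closedBall y (‖x - y‖ * s)) =
      ENNReal.ofReal (‖x - y‖ ^ 3) * lensVol s := by
  set a := ‖x - y‖ with ha
  have ha0 : 0 < a := norm_pos_iff.2 (sub_ne_zero.2 h)
  have hn : ‖a • unitE3‖ = ‖y - x‖ := by
    rw [norm_smul, norm_unitE3, mul_one, Real.norm_of_nonneg ha0.le, ha, norm_sub_rev]
  set L : E3 ≃ₗᵢ[ℝ] E3 := (ℝ ∙ (a • unitE3 - (y - x)))ᗮ.reflection with hL
  have hLe : a • L unitE3 = y - x := by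
    rw [← map_smul, hL, Submodule.reflection_sub hn]
  have e1 : closedBall (0 : E3) s ∩ closedBall unitE3 s =
      L ⁻¹' ((fun z : E3 => a • z) ⁻¹' ((fun z => x + z) ⁻¹'
        (closedBall x (a * s) ∩ closedBall y (a * s)))) := by
    ext z
    have h1 : x + a • L z - x = a • L z := by abel
    have h2 : x + a • L z - y = a • L (z - unitE3) := by
      rw [map_sub, smul_sub, hLe]; abel
    simp only [mem_inter_iff, mem_closedBall, mem_preimage, dist_eq_norm, h1, h2, norm_smul,
      L.norm_map, Real.norm_of_nonneg ha0.le, sub_zero, mul_le_mul_iff_right₀ ha0]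
  have hm : MeasurableSet (closedBall x (a * s) ∩ closedBall y (a * s)) :=
    measurableSet_closedBall.inter measurableSet_closedBall
  have h3 : Module.finrank ℝ E3 = 3 := by simp
  rw [lensVol, e1, L.measurePreserving.measure_preimage, Measure.addHaar_preimage_smul _ ha0.ne',
    measure_preimage_add, h3, ← mul_assoc, ← ENNReal.ofReal_mul (by positivity), abs_of_pos
      (by positivity), mul_inv_cancel₀ (by positivity), ENNReal.ofReal_one, one_mul]
  exact (((measurable_const_add x) hm).preimage (by fun_prop)).nullMeasurableSet

lemma lintegral_comp_mul_left_of_pos (f : ℝ → ℝ≥0∞) {a : ℝ} (ha : 0 < a) :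
    ∫⁻ r, f r = ENNReal.ofReal a * ∫⁻ s, f (a * s) := by
  have h1 := Real.smul_map_volume_mul_left ha.ne'
  have he : MeasurableEmbedding (fun s : ℝ => a * s) :=
    (Homeomorph.mulLeft₀ a ha.ne').measurableEmbedding
  conv_lhs => rw [← h1]
  rw [lintegral_smul_measure, abs_of_pos ha, he.lintegral_map]
  rfl

lemma measurableSet_mem_closedBall (x : E3) :
    MeasurableSet {p : E3 × ℝ | x ∈ closedBall p.1 p.2} := by
  have : IsClosed {p : E3 × ℝ | x ∈ closedBall p.1 p.2} :=
    isClosed_le (f := fun p : E3 × ℝ => dist x p.1) (g := fun p => p.2) (by fun_prop) (by fun_prop)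
  exact this.measurableSet

lemma ballMeasure_mem_mem {x y : E3} (h : x ≠ y) :
    ballMeasure {p | x ∈ closedBall p.1 p.2 ∧ y ∈ closedBall p.1 p.2} =
      ENNReal.ofReal (‖x - y‖⁻¹) * kernelConst := by
  have ha0 : 0 < ‖x - y‖ := norm_pos_iff.2 (sub_ne_zero.2 h)
  have hm := (measurableSet_mem_closedBall x).inter (measurableSet_mem_closedBall y)
  change ballMeasure ({p | x ∈ closedBall p.1 p.2} ∩ {p | y ∈ closedBall p.1 p.2}) = _
  rw [ballMeasure, Measure.prod_apply_symm hm]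
  have hs (r : ℝ) : (fun z : E3 => (z, r)) ⁻¹'
      ({p : E3 × ℝ | x ∈ closedBall p.1 p.2} ∩ {p | y ∈ closedBall p.1 p.2}) =
      closedBall x r ∩ closedBall y r := by
    ext z; simp [dist_comm]
  simp_rw [hs]
  rw [lintegral_radiusMeasure, lintegral_comp_mul_left_of_pos _ ha0, kernelConst,
    lintegral_radiusMeasure]
  simp_rw [volume_inter_closedBall h]
  rw [← lintegral_const_mul' _ _ ENNReal.ofReal_ne_top,
    ← lintegral_const_mul' _ _ ENNReal.ofReal_ne_top]
  congr 1 with s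
  rw [mul_pow, mul_inv, ENNReal.ofReal_mul (by positivity)]
  have : ENNReal.ofReal ‖x - y‖⁻¹ = ENNReal.ofReal ‖x - y‖ *
      ENNReal.ofReal ((‖x - y‖ ^ 5)⁻¹) * ENNReal.ofReal (‖x - y‖ ^ 3) := by
    rw [← ENNReal.ofReal_mul (by positivity), ← ENNReal.ofReal_mul (by positivity)]
    congr 1
    field_simp
  rw [this]
  ring

/-- The volume of the unit ball of `E3`. -/
def unitBallVol : ℝ≥0∞ := volume (ball (0 : E3) 1)

lemma unitBallVol_ne_top : unitBallVol ≠ ∞ := measure_ball_lt_top.ne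

lemma volume_closedBall_E3 (x : E3) {r : ℝ} (hr : 0 ≤ r) :
    volume (closedBall x r) = ENNReal.ofReal (r ^ 3) * unitBallVol := by
  rw [Measure.addHaar_closedBall _ _ hr]; simp [unitBallVol]

lemma lintegral_Ioi_inv_sq_lt_top {c : ℝ} (hc : 0 < c) :
    ∫⁻ r in Ioi c, ENNReal.ofReal ((r ^ 2)⁻¹) < ∞ := by
  have h := (integrableOn_Ioi_rpow_of_lt (a := -2) (by norm_num) hc).lintegral_lt_top
  refine lt_of_le_of_lt (le_of_eq ?_) h
  refine setLIntegral_congr_fun measurableSet_Ioi fun r hr => ?_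
  have : 0 < r := hc.trans hr
  rw [Real.rpow_neg this.le]
  norm_cast

lemma kernelConst_ne_top : kernelConst ≠ ∞ := by
  rw [kernelConst, lintegral_radiusMeasure]
  refine ne_top_of_le_ne_top (b := ∫⁻ r in Ioi (1 / 3 : ℝ),
    ENNReal.ofReal ((r ^ 2)⁻¹) * unitBallVol) ?_ ?_
  · rw [lintegral_mul_const' _ _ unitBallVol_ne_top]
    exact ENNReal.mul_ne_top (lintegral_Ioi_inv_sq_lt_top (by norm_num)).ne unitBallVol_ne_top
  · rw [← lintegral_indicator measurableSet_Ioi]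
    refine lintegral_mono fun r => ?_
    by_cases hr : r ∈ Ioi (1 / 3 : ℝ)
    · have hr0 : 0 < r := lt_trans (by norm_num) (mem_Ioi.1 hr)
      rw [indicator_of_mem hr]
      calc _ ≤ ENNReal.ofReal ((r ^ 5)⁻¹) * (ENNReal.ofReal (r ^ 3) * unitBallVol) := by
            gcongr
            rw [← volume_closedBall_E3 0 hr0.le]
            exact measure_mono inter_subset_left
        _ = _ := by
            rw [← mul_assoc, ← ENNReal.ofReal_mul (by positivity)]
            congr 2
            field_simp
    · have : closedBall (0 : E3) r ∩ closedBall unitE3 r = ∅ := by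
        rw [eq_empty_iff_forall_notMem]
        rintro z ⟨h1, h2⟩
        have h3 := dist_triangle_left (0 : E3) unitE3 z
        rw [dist_zero_left, norm_unitE3] at h3
        rw [mem_closedBall] at h1 h2
        simp only [mem_Ioi, not_lt] at hr
        linarith
      simp [lensVol, this]

lemma kernelConst_ne_zero : kernelConst ≠ 0 := by
  rw [kernelConst, lintegral_radiusMeasure]
  have hpos : 0 < unitBallVol := measure_ball_pos _ _ one_pos
  have hle : ∫⁻ r in Icc (2 : ℝ) 3, ENNReal.ofReal (3 ^ 5)⁻¹ * unitBallVol ≤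
      ∫⁻ r, ENNReal.ofReal ((r ^ 5)⁻¹) * lensVol r := by
    rw [← lintegral_indicator measurableSet_Icc]
    refine lintegral_mono (indicator_le fun r hr => ?_)
    have : (0 : ℝ) < r := by linarith [hr.1]
    gcongr
    · exact hr.2
    · refine measure_mono (subset_inter ?_ ?_)
      · exact ball_subset_closedBall.trans (closedBall_subset_closedBall (by linarith [hr.1]))
      · intro z hz
        rw [mem_ball_zero_iff] at hz
        rw [mem_closedBall, dist_eq_norm]
        have := norm_sub_le z unitE3
        rw [norm_unitE3] at this
        linarith [hr.1]
  refine (lt_of_lt_of_le ?_ hle).ne'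
  rw [setLIntegral_const]
  refine ENNReal.mul_pos (ENNReal.mul_pos ?_ hpos.ne').ne' ?_ <;> norm_num

/-- The charge contained in the ball with parameters `p`. -/
def ballCharge (f : E3 → ℝ) (p : E3 × ℝ) : ℝ := ∫ x in closedBall p.1 p.2, f x

lemma setLIntegral_inv_norm_lt_top :
    ∫⁻ z in closedBall (0 : E3) 1, ENNReal.ofReal (‖z‖⁻¹) < ∞ := by
  have h : LocallyIntegrable (fun z : E3 => ‖z‖⁻¹) :=
    locallyIntegrable_of_norm_le_rpow (C := 1) (α := 1) (by simp) (by simp)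
      (ae_of_all _ fun z => by rw [Real.rpow_neg_one, norm_inv, norm_norm, one_mul])
      (Measurable.aestronglyMeasurable (by fun_prop))
  exact (h.integrableOn_isCompact (isCompact_closedBall 0 1)).lintegral_lt_top

lemma exists_lintegral_mul_inv_norm_le {f : E3 → ℝ} (hf : Integrable f)
    (hb : ∀ᵐ x, |f x| ≤ 1) :
    ∃ A : ℝ≥0∞, A ≠ ∞ ∧ ∀ x, ∫⁻ y, ‖f y‖ₑ * ENNReal.ofReal (‖x - y‖⁻¹) ≤ A := by
  refine ⟨(∫⁻ z in closedBall (0 : E3) 1, ENNReal.ofReal (‖z‖⁻¹)) + ∫⁻ y, ‖f y‖ₑ,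
    ENNReal.add_ne_top.2 ⟨setLIntegral_inv_norm_lt_top.ne, hf.2.ne⟩, fun x => ?_⟩
  have hx : (∫⁻ z in closedBall (0 : E3) 1, ENNReal.ofReal (‖z‖⁻¹)) =
      ∫⁻ y, (closedBall (0 : E3) 1).indicator (fun z => ENNReal.ofReal (‖z‖⁻¹)) (x - y) := by
    rw [lintegral_sub_left_eq_self
      (fun z => (closedBall (0 : E3) 1).indicator (fun z => ENNReal.ofReal (‖z‖⁻¹)) z) x,
      lintegral_indicator measurableSet_closedBall]
  have hm : Measurable fun y : E3 =>
      (closedBall (0 : E3) 1).indicator (fun z => ENNReal.ofReal (‖z‖⁻¹)) (x - y) :=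
    (Measurable.indicator (by fun_prop) measurableSet_closedBall).comp (measurable_const_sub x)
  rw [hx, ← lintegral_add_left hm]
  refine lintegral_mono_ae (hb.mono fun y hy => ?_)
  by_cases h : x - y ∈ closedBall (0 : E3) 1
  · rw [indicator_of_mem h]
    refine le_add_of_le_left (mul_le_of_le_one_left' ?_)
    rw [← Real.norm_eq_abs] at hy
    rw [← ofReal_norm]
    exact ENNReal.ofReal_le_one.2 hy
  · refine le_add_of_le_right (mul_le_of_le_one_right' ?_)
    rw [mem_closedBall_zero_iff, not_le] at h
    exact ENNReal.ofReal_le_one.2 (inv_le_one_of_one_le₀ h.le)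

lemma lintegral_prod_mul_inv_norm_ne_top {f : E3 → ℝ} (hf : Integrable f)
    (hb : ∀ᵐ x, |f x| ≤ 1) :
    ∫⁻ q : E3 × E3, ‖f q.1‖ₑ * ‖f q.2‖ₑ * ENNReal.ofReal (‖q.1 - q.2‖⁻¹) ≠ ∞ := by
  obtain ⟨A, hA, h⟩ := exists_lintegral_mul_inv_norm_le hf hb
  have h1 : AEMeasurable (fun q : E3 × E3 => ‖f q.1‖ₑ) :=
    (hf.1.comp_fst (ν := (volume : Measure E3))).enorm
  have h2 : AEMeasurable (fun q : E3 × E3 => ‖f q.2‖ₑ) :=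
    (hf.1.comp_snd (μ := (volume : Measure E3))).enorm
  have h3 : Measurable (fun q : E3 × E3 => ENNReal.ofReal (‖q.1 - q.2‖⁻¹)) := by fun_prop
  refine ne_top_of_le_ne_top (b := (∫⁻ x, ‖f x‖ₑ) * A) (ENNReal.mul_ne_top hf.2.ne hA) ?_
  rw [Measure.volume_eq_prod, lintegral_prod (fun q : E3 × E3 =>
    ‖f q.1‖ₑ * ‖f q.2‖ₑ * ENNReal.ofReal (‖q.1 - q.2‖⁻¹)) ((h1.mul h2).mul h3.aemeasurable),
    ← lintegral_mul_const' _ _ hA]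
  refine lintegral_mono fun x => ?_
  simp only [mul_assoc]
  rw [lintegral_const_mul' _ _ enorm_ne_top]
  gcongr
  exact h x

lemma ae_fst_ne_snd : ∀ᵐ q : E3 × E3, q.1 ≠ q.2 := by
  have hd : MeasurableSet {q : E3 × E3 | q.1 = q.2} :=
    (isClosed_eq continuous_fst continuous_snd).measurableSet
  rw [ae_iff]
  simp only [ne_eq, not_not]
  rw [Measure.volume_eq_prod, Measure.measure_prod_null hd]
  refine ae_of_all _ fun x => ?_
  have : Prod.mk x ⁻¹' {q : E3 × E3 | q.1 = q.2} = {x} := by ext y; simp [eq_comm]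
  simp only [this, Pi.zero_apply, measure_singleton]

/-- Pairs of points together with a ball containing both. -/
def pairBallSet : Set ((E3 × E3) × (E3 × ℝ)) :=
  {z | z.1.1 ∈ closedBall z.2.1 z.2.2} ∩ {z | z.1.2 ∈ closedBall z.2.1 z.2.2}

lemma measurableSet_pairBallSet : MeasurableSet pairBallSet := by
  have h1 : IsClosed {z : (E3 × E3) × (E3 × ℝ) | z.1.1 ∈ closedBall z.2.1 z.2.2} :=
    isClosed_le (f := fun z : (E3 × E3) × (E3 × ℝ) => dist z.1.1 z.2.1) (g := fun z => z.2.2)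
      (by fun_prop) (by fun_prop)
  have h2 : IsClosed {z : (E3 × E3) × (E3 × ℝ) | z.1.2 ∈ closedBall z.2.1 z.2.2} :=
    isClosed_le (f := fun z : (E3 × E3) × (E3 × ℝ) => dist z.1.2 z.2.1) (g := fun z => z.2.2)
      (by fun_prop) (by fun_prop)
  exact (h1.inter h2).measurableSet

lemma pairBallSet_section (q : E3 × E3) : Prod.mk q ⁻¹' pairBallSet =
    {p | q.1 ∈ closedBall p.1 p.2 ∧ q.2 ∈ closedBall p.1 p.2} := rfl

lemma measurableSet_pairBallSet_section (q : E3 × E3) :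
    MeasurableSet {p : E3 × ℝ | q.1 ∈ closedBall p.1 p.2 ∧ q.2 ∈ closedBall p.1 p.2} :=
  (measurableSet_mem_closedBall q.1).inter (measurableSet_mem_closedBall q.2)

lemma integrable_pairBallSet_indicator {f : E3 → ℝ} (hf : Integrable f)
    (hb : ∀ᵐ x, |f x| ≤ 1) :
    Integrable (pairBallSet.indicator fun z => f z.1.1 * f z.1.2)
      ((volume : Measure (E3 × E3)).prod ballMeasure) := by
  have hff : AEStronglyMeasurable (fun q : E3 × E3 => f q.1 * f q.2) :=
    (hf.1.comp_fst (ν := (volume : Measure E3))).mul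
      (hf.1.comp_snd (μ := (volume : Measure E3)))
  have hm : AEStronglyMeasurable (pairBallSet.indicator fun z => f z.1.1 * f z.1.2)
      ((volume : Measure (E3 × E3)).prod ballMeasure) :=
    (hff.comp_fst (ν := ballMeasure)).indicator measurableSet_pairBallSet
  refine ⟨hm, ?_⟩
  rw [hasFiniteIntegral_iff_enorm, lintegral_prod _ hm.enorm]
  have key : ∀ᵐ q : E3 × E3,
      ∫⁻ p, ‖pairBallSet.indicator (fun z => f z.1.1 * f z.1.2) (q, p)‖ₑ ∂ballMeasure =
      ‖f q.1‖ₑ * ‖f q.2‖ₑ * ENNReal.ofReal (‖q.1 - q.2‖⁻¹) * kernelConst := by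
    filter_upwards [ae_fst_ne_snd] with q hq
    rw [mul_assoc _ _ kernelConst, ← ballMeasure_mem_mem hq,
      ← lintegral_indicator_const (measurableSet_pairBallSet_section q)]
    refine lintegral_congr fun p => ?_
    rw [enorm_indicator_eq_indicator_enorm]
    simp only [indicator, enorm_mul, ← pairBallSet_section]
    rfl
  rw [lintegral_congr_ae key, lintegral_mul_const' _ _ kernelConst_ne_top]
  exact (ENNReal.mul_ne_top (lintegral_prod_mul_inv_norm_ne_top hf hb) kernelConst_ne_top).lt_top

lemma integral_pairBallSet_indicator_left (f : E3 → ℝ) (p : E3 × ℝ) :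
    ∫ q : E3 × E3, pairBallSet.indicator (fun z => f z.1.1 * f z.1.2) (q, p) =
      ballCharge f p ^ 2 := by
  rw [ballCharge, ← integral_indicator measurableSet_closedBall, sq, ← integral_prod_mul,
    Measure.volume_eq_prod]
  refine integral_congr_ae (ae_of_all _ fun q => ?_)
  by_cases h1 : q.1 ∈ closedBall p.1 p.2 <;> by_cases h2 : q.2 ∈ closedBall p.1 p.2 <;>
    simp only [indicator, pairBallSet, mem_inter_iff, mem_ofPred_eq, h1, h2, and_true,
      and_false, if_true, if_false, mul_zero, zero_mul]

lemma integrable_ballCharge_sq {f : E3 → ℝ} (hf : Integrable f) (hb : ∀ᵐ x, |f x| ≤ 1) :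
    Integrable (fun p => ballCharge f p ^ 2) ballMeasure := by
  simpa only [integral_pairBallSet_indicator_left] using
    (integrable_pairBallSet_indicator hf hb).integral_prod_right

/-- The proportionality factor between the Coulomb energy and the ball energy. -/
def coulConst : ℝ := (4 * π * kernelConst.toReal)⁻¹

lemma coulConst_pos : 0 < coulConst := by
  have := ENNReal.toReal_pos kernelConst_ne_zero kernelConst_ne_top
  unfold coulConst
  positivity

/-- The Fefferman–de la Llave representation of the Coulomb energy. -/
lemma coulomb_energy_eq {f : E3 → ℝ} (hf : Integrable f) (hb : ∀ᵐ x, |f x| ≤ 1) :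
    ∫ x, ∫ y, f x * (f y * coul x y) =
      coulConst * ∫ p, ballCharge f p ^ 2 ∂ballMeasure := by
  have hI := integrable_pairBallSet_indicator hf hb
  have hC := ENNReal.toReal_pos kernelConst_ne_zero kernelConst_ne_top
  have key : ∀ᵐ q : E3 × E3, coulConst *
      ∫ p, pairBallSet.indicator (fun z => f z.1.1 * f z.1.2) (q, p) ∂ballMeasure =
      f q.1 * (f q.2 * coul q.1 q.2) := by
    filter_upwards [ae_fst_ne_snd] with q hq
    have e : (fun p => pairBallSet.indicator (fun z => f z.1.1 * f z.1.2) (q, p)) =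
        (Prod.mk q ⁻¹' pairBallSet).indicator fun _ => f q.1 * f q.2 := rfl
    rw [e, pairBallSet_section, integral_indicator_const _ (measurableSet_pairBallSet_section q),
      Measure.real, ballMeasure_mem_mem hq, ENNReal.toReal_mul,
      ENNReal.toReal_ofReal (by positivity), coul, coulConst, smul_eq_mul]
    have : ‖q.1 - q.2‖ ≠ 0 := norm_ne_zero_iff.2 (sub_ne_zero.2 hq)
    field_simp
  have hint : Integrable (fun q : E3 × E3 => f q.1 * (f q.2 * coul q.1 q.2)) :=
    (hI.integral_prod_left.const_mul coulConst).congr key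
  rw [Measure.volume_eq_prod] at hint
  rw [← integral_prod _ hint, ← Measure.volume_eq_prod, ← integral_congr_ae key,
    integral_const_mul]
  simp_rw [← integral_pairBallSet_indicator_left]
  congr 1
  exact integral_integral_swap hI

lemma ae_eq_zero_of_ballCharge_ae_eq_zero {f : E3 → ℝ} (hf : Integrable f)
    (h : ∀ᵐ p ∂ballMeasure, ballCharge f p = 0) : f =ᵐ[volume] 0 := by
  have h1 := Measure.ae_ae_of_ae_prod h
  filter_upwards [h1, IsUnifLocDoublingMeasure.ae_tendsto_average (μ := (volume : Measure E3))
    hf.locallyIntegrable 1] with z hz hav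
  have hlim := hav (l := 𝓝[>] (0 : ℝ)) (fun _ => z) id tendsto_id
    (eventually_nhdsWithin_of_forall fun r (hr : 0 < r) => by simpa using hr.le)
  rw [radiusMeasure, ae_withDensity_iff (by fun_prop)] at hz
  have hfreq : ∃ᶠ r in 𝓝[>] (0 : ℝ), (⨍ y in closedBall z (id r), f y) ∈ ({0} : Set ℝ) := by
    intro hne
    obtain ⟨ε, hε, hsub⟩ := mem_nhdsGT_iff_exists_Ioo_subset.1 hne
    have hnull : volume (Ioo 0 ε) = 0 := by
      refine measure_mono_null (fun r hr => ?_) (ae_iff.1 hz)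
      have hr0 : 0 < r := hr.1
      intro hcontra
      refine hsub hr ?_
      have h0 : ballCharge f (z, r) = 0 :=
        hcontra (by rw [ne_eq, ENNReal.ofReal_eq_zero, not_le]; positivity)
      rw [ballCharge] at h0
      simp only [id, setAverage_eq, h0, smul_zero, mem_singleton_iff]
    rw [Real.volume_Ioo, ENNReal.ofReal_eq_zero] at hnull
    linarith [mem_Ioi.1 hε]
  exact isClosed_singleton.mem_of_frequently_of_tendsto hfreq hlim

/-- Fatou's lemma for real-valued functions with bounded integrals. -/
lemma integrable_and_integral_le_of_tendsto_ae {α : Type*} [MeasurableSpace α] {μ : Measure α}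
    {g : ℕ → α → ℝ} {g' : α → ℝ} {b : ℝ} (hg : ∀ n, Integrable (g n) μ)
    (h0 : ∀ n, 0 ≤ᵐ[μ] g n) (hb : ∀ n, ∫ x, g n x ∂μ ≤ b)
    (hlim : ∀ᵐ x ∂μ, Tendsto (fun n => g n x) atTop (𝓝 (g' x))) :
    Integrable g' μ ∧ ∫ x, g' x ∂μ ≤ b := by
  have hm : AEStronglyMeasurable g' μ :=
    aestronglyMeasurable_of_tendsto_ae atTop (fun n => (hg n).1) hlim
  have h0' : 0 ≤ᵐ[μ] g' := by
    filter_upwards [ae_all_iff.2 h0, hlim] with x hx hl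
    exact ge_of_tendsto' hl hx
  have hb0 : 0 ≤ b := (integral_nonneg_of_ae (h0 0)).trans (hb 0)
  have key : ∫⁻ x, ENNReal.ofReal (g' x) ∂μ ≤ ENNReal.ofReal b := by
    calc ∫⁻ x, ENNReal.ofReal (g' x) ∂μ
        = ∫⁻ x, liminf (fun n => ENNReal.ofReal (g n x)) atTop ∂μ := by
          refine lintegral_congr_ae (hlim.mono fun x hx => ?_)
          exact ((ENNReal.continuous_ofReal.tendsto _).comp hx).liminf_eq.symm
      _ ≤ liminf (fun n => ∫⁻ x, ENNReal.ofReal (g n x) ∂μ) atTop :=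
          lintegral_liminf_le' fun n => (hg n).1.aemeasurable.ennreal_ofReal
      _ ≤ ENNReal.ofReal b := by
          refine liminf_le_of_frequently_le' (Frequently.of_forall fun n => ?_)
          rw [← ofReal_integral_eq_lintegral_ofReal (hg n) (h0 n)]
          exact ENNReal.ofReal_le_ofReal (hb n)
  refine ⟨⟨hm, ?_⟩, ?_⟩
  · rw [hasFiniteIntegral_iff_ofReal h0']
    exact key.trans_lt ENNReal.ofReal_lt_top
  · rw [integral_eq_lintegral_of_nonneg_ae h0' hm]
    exact ENNReal.toReal_le_of_le_ofReal hb0 key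

/-- The charge density `χ_{Ω⁺} − u`. -/
def chargeDensity (Ωp : Set E3) (u : E3 → ℝ) (x : E3) : ℝ :=
  indicator Ωp (fun _ => (1 : ℝ)) x - u x

section Admissible

variable {Ωp : Set E3} {lam : ℝ} {u v : E3 → ℝ}

lemma RelAdm.integrable_chargeDensity (ho : IsOpen Ωp) (hfin : volume Ωp ≠ ∞)
    (hu : RelAdm Ωp lam u) : Integrable (chargeDensity Ωp u) :=
  ((integrable_indicator_iff ho.measurableSet).2 (integrableOn_const hfin)).sub hu.1

lemma RelAdm.abs_chargeDensity_le (hu : RelAdm Ωp lam u) :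
    ∀ᵐ x, |chargeDensity Ωp u x| ≤ 1 := by
  filter_upwards [hu.2.1] with x hx
  have h1 : 0 ≤ indicator Ωp (fun _ => (1 : ℝ)) x := indicator_nonneg (fun _ _ => zero_le_one) x
  have h2 : indicator Ωp (fun _ => (1 : ℝ)) x ≤ 1 := indicator_le_self' (fun _ _ => zero_le_one) x
  rw [chargeDensity, abs_le]
  constructor <;> linarith [hx.1, hx.2]

lemma RelAdm.relEnergy_eq (ho : IsOpen Ωp) (hfin : volume Ωp ≠ ∞) (hu : RelAdm Ωp lam u) :
    relEnergy Ωp u =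
      coulConst * ∫ p, ballCharge (chargeDensity Ωp u) p ^ 2 ∂ballMeasure :=
  coulomb_energy_eq (hu.integrable_chargeDensity ho hfin) hu.abs_chargeDensity_le

lemma RelAdm.relEnergy_nonneg (ho : IsOpen Ωp) (hfin : volume Ωp ≠ ∞) (hu : RelAdm Ωp lam u) :
    0 ≤ relEnergy Ωp u := by
  rw [hu.relEnergy_eq ho hfin]
  exact mul_nonneg coulConst_pos.le (integral_nonneg fun p => sq_nonneg _)

lemma RelAdm.congr (hu : RelAdm Ωp lam u) (h : u =ᵐ[volume] v) : RelAdm Ωp lam v := by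
  refine ⟨hu.1.congr h, ?_, ?_, (integral_congr_ae h) ▸ hu.2.2.2⟩
  · filter_upwards [h, hu.2.1] with x hx hx'
    rwa [← hx]
  · filter_upwards [h, hu.2.2.1] with x hx hx'
    rwa [← hx]

lemma relEnergy_congr (h : u =ᵐ[volume] v) : relEnergy Ωp u = relEnergy Ωp v := by
  refine integral_congr_ae (h.mono fun x hx => ?_)
  simp only [hx]
  refine integral_congr_ae (h.mono fun y hy => ?_)
  simp only [hy]

lemma RelAdm.convexComb (hu : RelAdm Ωp lam u) (hv : RelAdm Ωp lam v) {a b : ℝ}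
    (ha : 0 ≤ a) (hb : 0 ≤ b) (hab : a + b = 1) :
    RelAdm Ωp lam (fun x => a * u x + b * v x) := by
  refine ⟨(hu.1.const_mul a).add (hv.1.const_mul b), ?_, ?_, ?_⟩
  · filter_upwards [hu.2.1, hv.2.1] with x hx hx'
    constructor
    · have := mul_nonneg ha hx.1
      have := mul_nonneg hb hx'.1
      linarith
    · have := mul_le_mul_of_nonneg_left hx.2 ha
      have := mul_le_mul_of_nonneg_left hx'.2 hb
      linarith
  · filter_upwards [hu.2.2.1, hv.2.2.1] with x hx hx' hΩ
    rw [hx hΩ, hx' hΩ]; ring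
  · rw [integral_add (hu.1.const_mul a) (hv.1.const_mul b), integral_const_mul,
      integral_const_mul]
    have := mul_le_mul_of_nonneg_left hu.2.2.2 ha
    have := mul_le_mul_of_nonneg_left hv.2.2.2 hb
    have h : a * lam + b * lam = lam := by rw [← add_mul, hab, one_mul]
    linarith

lemma RelAdm.abs_sub_le (hu : RelAdm Ωp lam u) (hv : RelAdm Ωp lam v) :
    ∀ᵐ x, |u x - v x| ≤ 1 := by
  filter_upwards [hu.2.1, hv.2.1] with x hx hx'
  rw [abs_le]
  constructor <;> linarith [hx.1, hx.2, hx'.1, hx'.2]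

lemma RelAdm.relEnergy_convexComb (ho : IsOpen Ωp) (hfin : volume Ωp ≠ ∞)
    (hu : RelAdm Ωp lam u) (hv : RelAdm Ωp lam v) {a b : ℝ}
    (ha : 0 ≤ a) (hb : 0 ≤ b) (hab : a + b = 1) :
    relEnergy Ωp (fun x => a * u x + b * v x) = a * relEnergy Ωp u + b * relEnergy Ωp v -
      a * b * (coulConst * ∫ p, ballCharge (fun x => u x - v x) p ^ 2 ∂ballMeasure) := by
  have hIu := hu.integrable_chargeDensity ho hfin
  have hIv := hv.integrable_chargeDensity ho hfin
  have hId : Integrable fun x => u x - v x := hu.1.sub hv.1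
  have hpt (p : E3 × ℝ) : ballCharge (chargeDensity Ωp fun x => a * u x + b * v x) p ^ 2 =
      a * ballCharge (chargeDensity Ωp u) p ^ 2 + b * ballCharge (chargeDensity Ωp v) p ^ 2 -
        a * b * ballCharge (fun x => u x - v x) p ^ 2 := by
    have e1 : ballCharge (chargeDensity Ωp fun x => a * u x + b * v x) p =
        a * ballCharge (chargeDensity Ωp u) p + b * ballCharge (chargeDensity Ωp v) p := by
      simp only [ballCharge]
      rw [← integral_const_mul, ← integral_const_mul, ← integral_add
        (hIu.integrableOn.const_mul a) (hIv.integrableOn.const_mul b)]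
      congr 1 with x
      simp only [chargeDensity]
      linear_combination (-(indicator Ωp (fun _ => (1 : ℝ)) x)) * hab
    have e2 : ballCharge (fun x => u x - v x) p =
        ballCharge (chargeDensity Ωp v) p - ballCharge (chargeDensity Ωp u) p := by
      simp only [ballCharge]
      rw [← integral_sub hIv.integrableOn hIu.integrableOn]
      congr 1 with x
      simp only [chargeDensity]
      ring
    rw [e1, e2]
    obtain rfl : b = 1 - a := by linarith
    ring
  have q1 := integrable_ballCharge_sq hIu hu.abs_chargeDensity_le
  have q2 := integrable_ballCharge_sq hIv hv.abs_chargeDensity_le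
  have q3 := integrable_ballCharge_sq hId (hu.abs_sub_le hv)
  rw [(hu.convexComb hv ha hb hab).relEnergy_eq ho hfin, hu.relEnergy_eq ho hfin,
    hv.relEnergy_eq ho hfin]
  simp_rw [hpt]
  have q12 : Integrable (fun p => a * ballCharge (chargeDensity Ωp u) p ^ 2 +
      b * ballCharge (chargeDensity Ωp v) p ^ 2) ballMeasure :=
    (q1.const_mul a).add (q2.const_mul b)
  rw [integral_sub q12 (q3.const_mul (a * b)),
    integral_add (q1.const_mul a) (q2.const_mul b), integral_const_mul, integral_const_mul,
    integral_const_mul]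
  ring

lemma RelAdm.ae_eq_of_minimal (ho : IsOpen Ωp) (hfin : volume Ωp ≠ ∞)
    (hu : RelAdm Ωp lam u) (hv : RelAdm Ωp lam v)
    (hmu : ∀ w, RelAdm Ωp lam w → relEnergy Ωp u ≤ relEnergy Ωp w)
    (hmv : ∀ w, RelAdm Ωp lam w → relEnergy Ωp v ≤ relEnergy Ωp w) : v =ᵐ[volume] u := by
  have hmid := hmu _ (hu.convexComb hv (a := 1 / 2) (b := 1 / 2) (by norm_num) (by norm_num)
    (by norm_num))
  rw [hu.relEnergy_convexComb ho hfin hv (by norm_num) (by norm_num) (by norm_num)] at hmid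
  have hvu := hmv u hu
  have hInt := integrable_ballCharge_sq (hu.1.sub hv.1) (hu.abs_sub_le hv)
  have hnn : 0 ≤ ∫ p, ballCharge (fun x => u x - v x) p ^ 2 ∂ballMeasure :=
    integral_nonneg fun p => sq_nonneg _
  have hle : coulConst * ∫ p, ballCharge (fun x => u x - v x) p ^ 2 ∂ballMeasure ≤ 0 := by
    linarith
  have h0 : ∫ p, ballCharge (fun x => u x - v x) p ^ 2 ∂ballMeasure = 0 :=
    le_antisymm (nonpos_of_mul_nonpos_right hle coulConst_pos) hnn
  have hae := (integral_eq_zero_iff_of_nonneg (fun p => sq_nonneg _) hInt).1 h0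
  have := ae_eq_zero_of_ballCharge_ae_eq_zero (hu.1.sub hv.1)
    (hae.mono fun p hp => pow_eq_zero_iff two_ne_zero |>.1 hp)
  filter_upwards [this] with x hx
  exact (sub_eq_zero.1 hx).symm

lemma RelAdm.of_tendsto_ae {w : ℕ → E3 → ℝ} (hw : ∀ n, RelAdm Ωp lam (w n))
    (hlim : ∀ᵐ x, Tendsto (fun n => w n x) atTop (𝓝 (u x))) : RelAdm Ωp lam u := by
  have hF := integrable_and_integral_le_of_tendsto_ae (fun n => (hw n).1)
    (fun n => (hw n).2.1.mono fun x hx => hx.1) (fun n => (hw n).2.2.2) hlim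
  refine ⟨hF.1, ?_, ?_, hF.2⟩
  · filter_upwards [hlim, ae_all_iff.2 fun n => (hw n).2.1] with x hx h
    exact ⟨ge_of_tendsto' hx fun n => (h n).1, le_of_tendsto' hx fun n => (h n).2⟩
  · filter_upwards [hlim, ae_all_iff.2 fun n => (hw n).2.2.1] with x hx h hΩ
    refine tendsto_nhds_unique hx ?_
    simp only [h _ hΩ]
    exact tendsto_const_nhds

lemma RelAdm.relEnergy_le_of_tendsto_ae (ho : IsOpen Ωp) (hfin : volume Ωp ≠ ∞)
    {w : ℕ → E3 → ℝ} {b : ℝ} (hw : ∀ n, RelAdm Ωp lam (w n))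
    (hlim : ∀ᵐ x, Tendsto (fun n => w n x) atTop (𝓝 (u x)))
    (hb : ∀ n, relEnergy Ωp (w n) ≤ b) : relEnergy Ωp u ≤ b := by
  have hu : RelAdm Ωp lam u := .of_tendsto_ae hw hlim
  have hT (p : E3 × ℝ) : Tendsto (fun n => ballCharge (chargeDensity Ωp (w n)) p) atTop
      (𝓝 (ballCharge (chargeDensity Ωp u) p)) := by
    refine tendsto_integral_of_dominated_convergence (fun _ => 1)
      (fun n => ((hw n).integrable_chargeDensity ho hfin).1.restrict)
      (integrableOn_const measure_closedBall_lt_top.ne)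
      (fun n => ae_restrict_of_ae (hw n).abs_chargeDensity_le) (ae_restrict_of_ae ?_)
    filter_upwards [hlim] with x hx
    exact hx.const_sub _
  have h := integrable_and_integral_le_of_tendsto_ae
    (g := fun n p => ballCharge (chargeDensity Ωp (w n)) p ^ 2) (b := b / coulConst)
    (fun n => integrable_ballCharge_sq ((hw n).integrable_chargeDensity ho hfin)
      (hw n).abs_chargeDensity_le)
    (fun n => ae_of_all _ fun p => sq_nonneg _)
    (fun n => by
      rw [le_div_iff₀' coulConst_pos, ← (hw n).relEnergy_eq ho hfin]
      exact hb n)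
    (ae_of_all ballMeasure fun p => (hT p).pow 2)
  rw [hu.relEnergy_eq ho hfin, ← le_div_iff₀' coulConst_pos]
  exact h.2

lemma RelAdm.integrable_sq (hu : RelAdm Ωp lam u) : Integrable fun x => u x ^ 2 := by
  refine hu.1.mono' (hu.1.1.pow 2) (hu.2.1.mono fun x hx => ?_)
  rw [Real.norm_of_nonneg (sq_nonneg _)]
  nlinarith [hx.1, hx.2]

lemma RelAdm.memLp_two (hu : RelAdm Ωp lam u) : MemLp u 2 :=
  (memLp_two_iff_integrable_sq hu.1.1).2 hu.integrable_sq

lemma RelAdm.norm_le {g : Lp ℝ 2 (volume : Measure E3)} (hg : RelAdm Ωp lam g) :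
    ‖g‖ ≤ √lam := by
  refine Real.le_sqrt_of_sq_le ?_
  rw [← real_inner_self_eq_norm_sq, L2.inner_def]
  refine le_trans (integral_mono_ae (L2.integrable_inner g g) hg.1 ?_) hg.2.2.2
  filter_upwards [hg.2.1] with x hx
  change (g x) * (g x) ≤ g x
  nlinarith [hx.1, hx.2]

end Admissible

/-- A decreasing sequence of nonempty, closed, convex, bounded subsets of a Hilbert space has a
common point. -/
lemma exists_forall_mem_of_antitone_closed_convex {H : Type*} [NormedAddCommGroup H]
    [InnerProductSpace ℝ H] [CompleteSpace H] {K : ℕ → Set H} (hK : Antitone K)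
    (hne : ∀ n, (K n).Nonempty) (hcl : ∀ n, IsClosed (K n)) (hcv : ∀ n, Convex ℝ (K n))
    {R : ℝ} (hR : ∀ x ∈ K 0, ‖x‖ ≤ R) : ∃ x, ∀ n, x ∈ K n := by
  choose v hv hmin using fun n =>
    exists_norm_eq_iInf_of_complete_convex (hne n) (hcl n).isComplete (hcv n) 0
  have hmem {n m : ℕ} (h : n ≤ m) : v m ∈ K n := hK h (hv m)
  have key {n m : ℕ} (h : n ≤ m) : ‖v m - v n‖ ^ 2 ≤ ‖v m‖ ^ 2 - ‖v n‖ ^ 2 := by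
    have h1 := (norm_eq_iInf_iff_real_inner_le_zero (hcv n) (hv n)).1 (hmin n) (v m) (hmem h)
    rw [zero_sub, inner_neg_left, inner_sub_right, real_inner_self_eq_norm_sq] at h1
    rw [norm_sub_sq_real, real_inner_comm]
    linarith
  have hmono : Monotone fun n => ‖v n‖ ^ 2 := fun n m h => by
    have := key h
    have := sq_nonneg ‖v m - v n‖
    simp only
    linarith
  have hbdd : BddAbove (range fun n => ‖v n‖ ^ 2) := by
    refine ⟨R ^ 2, ?_⟩
    rintro _ ⟨n, rfl⟩
    exact pow_le_pow_left₀ (norm_nonneg _) (hR _ (hmem (Nat.zero_le n))) 2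
  have hcs := (tendsto_atTop_ciSup hmono hbdd).cauchySeq
  have hc : CauchySeq v := by
    rw [Metric.cauchySeq_iff'] at hcs ⊢
    intro ε hε
    obtain ⟨N, hN⟩ := hcs (ε ^ 2) (by positivity)
    refine ⟨N, fun n hn => ?_⟩
    have h1 := (le_abs_self _).trans_lt (Real.dist_eq _ _ ▸ hN n hn)
    rw [dist_eq_norm]
    exact lt_of_pow_lt_pow_left₀ 2 hε.le ((key hn).trans_lt h1)
  obtain ⟨x, hx⟩ := cauchySeq_tendsto_of_complete hc
  exact ⟨x, fun n => (hcl n).mem_of_tendsto hx (eventually_atTop.2 ⟨n, fun m hm => hmem hm⟩)⟩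

/-- The `L²` classes of admissible densities with energy at most `b`. -/
def energySublevel (Ωp : Set E3) (lam b : ℝ) : Set (Lp ℝ 2 (volume : Measure E3)) :=
  {g | RelAdm Ωp lam g ∧ relEnergy Ωp g ≤ b}

lemma isClosed_energySublevel {Ωp : Set E3} (ho : IsOpen Ωp) (hfin : volume Ωp ≠ ∞)
    (lam b : ℝ) : IsClosed (energySublevel Ωp lam b) := by
  refine IsSeqClosed.isClosed fun w g hw hg => ?_
  obtain ⟨φ, -, hφ⟩ := (tendstoInMeasure_of_tendsto_Lp hg).exists_seq_tendsto_ae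
  exact ⟨.of_tendsto_ae (fun n => (hw (φ n)).1) hφ,
    RelAdm.relEnergy_le_of_tendsto_ae ho hfin (fun n => (hw (φ n)).1) hφ fun n => (hw (φ n)).2⟩

lemma convex_energySublevel {Ωp : Set E3} (ho : IsOpen Ωp) (hfin : volume Ωp ≠ ∞)
    (lam b : ℝ) : Convex ℝ (energySublevel Ωp lam b) := by
  intro g hg h hh s t hs ht hst
  have hae : (fun x => s * g x + t * h x) =ᵐ[volume] (s • g + t • h : Lp ℝ 2 volume) := by
    filter_upwards [Lp.coeFn_add (s • g) (t • h), Lp.coeFn_smul s g, Lp.coeFn_smul t h]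
      with x h1 h2 h3
    rw [h1, Pi.add_apply, h2, h3]
    rfl
  refine ⟨(hg.1.convexComb hh.1 hs ht hst).congr hae, ?_⟩
  rw [← relEnergy_congr hae, hg.1.relEnergy_convexComb ho hfin hh.1 hs ht hst]
  have h1 : 0 ≤ s * t * (coulConst * ∫ p, ballCharge (fun x => g x - h x) p ^ 2 ∂ballMeasure) :=
    mul_nonneg (mul_nonneg hs ht)
      (mul_nonneg coulConst_pos.le (integral_nonneg fun p => sq_nonneg _))
  have h2 := mul_le_mul_of_nonneg_left hg.2 hs
  have h3 := mul_le_mul_of_nonneg_left hh.2 ht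
  have h4 : s * b + t * b = b := by rw [← add_mul, hst, one_mul]
  linarith

lemma exists_relEnergy_minimizer {Ωp : Set E3} (ho : IsOpen Ωp) (hfin : volume Ωp ≠ ∞)
    {lam : ℝ} (hlam : 0 ≤ lam) :
    ∃ u, RelAdm Ωp lam u ∧ ∀ v, RelAdm Ωp lam v → relEnergy Ωp u ≤ relEnergy Ωp v := by
  set S : Set ℝ := relEnergy Ωp '' {u | RelAdm Ωp lam u} with hS
  have hne : S.Nonempty := ⟨_, 0, ⟨integrable_zero _ _ _, by simp, by simp, by simpa⟩, rfl⟩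
  have hbdd : BddBelow S := ⟨0, by
    rintro _ ⟨u, hu, rfl⟩
    exact RelAdm.relEnergy_nonneg ho hfin hu⟩
  obtain ⟨g, hg⟩ := exists_forall_mem_of_antitone_closed_convex
    (K := fun n : ℕ => energySublevel Ωp lam (sInf S + 1 / ((n : ℝ) + 1))) (R := √lam)
    (fun n m hnm f hf => ⟨hf.1, hf.2.trans
      (add_le_add_right (one_div_le_one_div_of_le (by positivity) (by gcongr)) _)⟩)
    (fun n => by
      obtain ⟨_, ⟨u, hu, rfl⟩, hlt⟩ := exists_lt_of_csInf_lt hne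
        (lt_add_of_pos_right (sInf S) (by positivity : 0 < 1 / ((n : ℝ) + 1)))
      have hu' : RelAdm Ωp lam u := hu
      have hae := hu'.memLp_two.coeFn_toLp
      exact ⟨hu'.memLp_two.toLp u, hu'.congr hae.symm, (relEnergy_congr hae).trans_le hlt.le⟩)
    (fun n => isClosed_energySublevel ho hfin lam _)
    (fun n => convex_energySublevel ho hfin lam _)
    (fun f hf => hf.1.norm_le)
  refine ⟨g, (hg 0).1, fun v hv => le_trans ?_ (csInf_le hbdd ⟨v, hv, rfl⟩)⟩
  refine ge_of_tendsto' (f := fun n : ℕ => sInf S + 1 / ((n : ℝ) + 1)) (x := atTop) ?_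
    fun n => (hg n).2
  simpa using tendsto_one_div_add_atTop_nhds_zero_nat.const_add (sInf S)

end BallRepresentation

/-- **Proposition 3.2** (Minimizer for the relaxed problem): existence and
uniqueness (up to equality a.e.) of a minimizer of the relaxed problem. -/
theorem relaxed_existence_uniqueness
    (Ωp : Set E3) (ho : IsOpen Ωp) (hb : Bornology.IsBounded Ωp)
    (m : ℝ) (hm : 0 < m) (hvol : volume Ωp = ENNReal.ofReal m)
    (lam : ℝ) (hlam : 0 < lam) :
    ∃ u : E3 → ℝ, RelAdm Ωp lam u ∧
      (∀ v, RelAdm Ωp lam v → relEnergy Ωp u ≤ relEnergy Ωp v) ∧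
      (∀ v, RelAdm Ωp lam v → (∀ w, RelAdm Ωp lam w → relEnergy Ωp v ≤ relEnergy Ωp w) →
        v =ᵐ[volume] u) := by
  have hfin : volume Ωp ≠ ⊤ := hvol ▸ ENNReal.ofReal_ne_top
  obtain ⟨u, hu, hmin⟩ := exists_relEnergy_minimizer ho hfin hlam.le
  exact ⟨u, hu, hmin, fun v hv hmv => hu.ae_eq_of_minimal ho hfin hv hmin hmv⟩
end
end

section
/- Let Ω⁺ ⊂ ℝ³ be a bounded open set with |Ω⁺| = m > 0, let λ > 0, and let u be the minimizer of the relaxed problem min{ 𝓔(u) : u ∈ L¹(ℝ³;[0,1]), u = 0 a.e. on Ω⁺, ∫ u ≤ λ }. Then the associated potential φ_u satisfies φ_u(x) ≥ 0 for every x ∈ ℝ³. -/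
open MeasureTheory Real Filter

noncomputable section

theorem coul_nonneg (x y : E3) : 0 ≤ coul x y := by
  unfold coul; positivity

theorem coul_comm (x y : E3) : coul x y = coul y x := by
  unfold coul; rw [norm_sub_rev]

theorem coul_eq_sub (x y : E3) : coul x y = coul (x - y) 0 := by
  simp [coul]

theorem measurable_coul : Measurable (fun p : E3 × E3 => coul p.1 p.2) := by
  unfold coul; fun_prop

theorem integrable_indicator_coul (r : ℝ) :
    Integrable ((Metric.ball (0 : E3) r).indicator (fun z => coul z 0)) := by
  have h : ((Metric.ball (0 : E3) r).indicator (fun z => coul z 0))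
      = fun z : E3 => (fun s : ℝ => (Set.Iio r).indicator (fun s => 1 / (4 * π * s)) s) ‖z‖ := by
    funext z
    simp [Set.indicator, coul]
  rw [h, integrable_fun_norm_addHaar]
  have h2 : IntegrableOn (fun s : ℝ => (Set.Ioo 0 r).indicator (fun s => s / (4 * π)) s)
      (Set.Ioi 0) := by
    refine Integrable.integrableOn ?_
    rw [integrable_indicator_iff measurableSet_Ioo]
    exact ((continuous_id.div_const (4 * π)).integrableOn_Icc).mono_set Set.Ioo_subset_Icc_self
  refine h2.congr_fun (fun s hs => ?_) measurableSet_Ioi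
  have hs' : (0 : ℝ) < s := hs
  by_cases hr : s < r
  · simp [Set.indicator, hs', hr]
    field_simp
  · simp [Set.indicator, hr]

/-- The mass of the Coulomb kernel in a ball. -/
def coulBallMass (r : ℝ) : ℝ := ∫ z : E3, (Metric.ball (0 : E3) r).indicator (fun z => coul z 0) z

theorem tendsto_coulBallMass :
    Tendsto (fun n : ℕ => coulBallMass (1 / ((n : ℝ) + 1))) atTop (nhds 0) := by
  have h := tendsto_setIntegral_of_antitone (μ := (volume : Measure E3))
    (f := fun z : E3 => coul z 0) (s := fun n : ℕ => Metric.ball (0 : E3) (1 / ((n : ℝ) + 1)))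
    (fun _ => measurableSet_ball)
    (fun i j hij => Metric.ball_subset_ball (Nat.one_div_le_one_div hij))
    ⟨0, (integrable_indicator_iff measurableSet_ball).1 (integrable_indicator_coul _)⟩
  have h0 : (⋂ n : ℕ, Metric.ball (0 : E3) (1 / ((n : ℝ) + 1))) = {0} := by
    ext z
    simp only [Set.mem_iInter, mem_ball_zero_iff, Set.mem_singleton_iff]
    constructor
    · intro hz
      by_contra hne
      obtain ⟨n, hn⟩ := exists_nat_one_div_lt (norm_pos_iff.2 hne)
      exact absurd (hz n) (not_lt.2 hn.le)
    · rintro rfl n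
      simpa using (by positivity : (0 : ℝ) < (n : ℝ) + 1)
  rw [h0] at h
  simp only [setIntegral_measure_zero (fun z : E3 => coul z 0) (measure_singleton (0 : E3))] at h
  refine h.congr (fun n => ?_)
  rw [coulBallMass, integral_indicator measurableSet_ball]

theorem coul_le_indicator_add (x y : E3) :
    coul x y ≤ (Metric.ball (0 : E3) 1).indicator (fun z => coul z 0) (x - y) + 1 := by
  by_cases h : x - y ∈ Metric.ball (0 : E3) 1
  · rw [Set.indicator_of_mem h, ← coul_eq_sub]; linarith
  · rw [Set.indicator_of_notMem h, zero_add]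
    have h1 : 1 ≤ ‖x - y‖ := by simpa using h
    unfold coul
    rw [div_le_one (by positivity)]
    nlinarith [pi_gt_three]

theorem norm_mul_coul_le {f : E3 → ℝ} (hb : ∀ᵐ y, |f y| ≤ 1) (x : E3) :
    ∀ᵐ y, ‖f y * coul x y‖ ≤
      (Metric.ball (0 : E3) 1).indicator (fun z => coul z 0) (x - y) + |f y| := by
  filter_upwards [hb] with y hy
  rw [norm_mul, Real.norm_eq_abs, Real.norm_eq_abs, abs_of_nonneg (coul_nonneg x y)]
  have h1 := coul_le_indicator_add x y
  have h2 : 0 ≤ (Metric.ball (0 : E3) 1).indicator (fun z => coul z 0) (x - y) :=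
    Set.indicator_nonneg (fun z _ => coul_nonneg z 0) _
  nlinarith [abs_nonneg (f y)]

theorem integrable_indicator_coul_add {f : E3 → ℝ} (hf : Integrable f) (x : E3) :
    Integrable (fun y => (Metric.ball (0 : E3) 1).indicator (fun z => coul z 0) (x - y) + |f y|) :=
  ((integrable_indicator_coul 1).comp_sub_left x).add hf.abs

theorem aestronglyMeasurable_mul_coul {f : E3 → ℝ} (hf : Integrable f) (x : E3) :
    AEStronglyMeasurable (fun y => f y * coul x y) :=
  hf.aestronglyMeasurable.mul
    (measurable_coul.comp measurable_prodMk_left).aestronglyMeasurable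

theorem integrable_mul_coul {f : E3 → ℝ} (hf : Integrable f) (hb : ∀ᵐ y, |f y| ≤ 1) (x : E3) :
    Integrable (fun y => f y * coul x y) :=
  (integrable_indicator_coul_add hf x).mono' (aestronglyMeasurable_mul_coul hf x)
    (norm_mul_coul_le hb x)

theorem integral_norm_mul_coul_le {f : E3 → ℝ} (hf : Integrable f) (hb : ∀ᵐ y, |f y| ≤ 1)
    (x : E3) : ∫ y, ‖f y * coul x y‖ ≤ coulBallMass 1 + ∫ y, |f y| := by
  refine (integral_mono_ae (integrable_mul_coul hf hb x).norm
    (integrable_indicator_coul_add hf x) (norm_mul_coul_le hb x)).trans_eq ?_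
  rw [integral_add ((integrable_indicator_coul 1).comp_sub_left x) hf.abs,
    integral_sub_left_eq_self (fun z => (Metric.ball (0 : E3) 1).indicator (fun z => coul z 0) z)]
  rfl

/-- The Coulomb potential of a density. -/
def coulPot (f : E3 → ℝ) (x : E3) : ℝ := ∫ y, f y * coul x y

theorem integrable_prod_mul_coul {f g : E3 → ℝ} (hf : Integrable f) (hg : Integrable g)
    (hb : ∀ᵐ y, |g y| ≤ 1) :
    Integrable (fun p : E3 × E3 => f p.1 * (g p.2 * coul p.1 p.2)) (volume.prod volume) := by
  have hm : AEStronglyMeasurable (fun p : E3 × E3 => f p.1 * (g p.2 * coul p.1 p.2))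
      (volume.prod volume) :=
    hf.aestronglyMeasurable.comp_fst.mul
      (hg.aestronglyMeasurable.comp_snd.mul measurable_coul.aestronglyMeasurable)
  refine (integrable_prod_iff hm).2
    ⟨.of_forall fun x => (integrable_mul_coul hg hb x).const_mul (f x), ?_⟩
  refine (hf.norm.mul_const (coulBallMass 1 + ∫ y, |g y|)).mono' hm.norm.integral_prod_right'
    (.of_forall fun x => ?_)
  rw [Real.norm_of_nonneg (integral_nonneg fun _ => norm_nonneg _)]
  simp_rw [norm_mul (f x)]
  rw [integral_const_mul]
  exact mul_le_mul_of_nonneg_left (integral_norm_mul_coul_le hg hb x) (norm_nonneg _)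

theorem integrable_mul_coulPot {f g : E3 → ℝ} (hf : Integrable f) (hg : Integrable g)
    (hb : ∀ᵐ y, |g y| ≤ 1) : Integrable (fun x => f x * coulPot g x) := by
  refine (integrable_prod_mul_coul hf hg hb).integral_prod_left.congr (.of_forall fun x => ?_)
  simp only [coulPot, integral_const_mul]

theorem integral_mul_coulPot_comm {f g : E3 → ℝ} (hf : Integrable f) (hg : Integrable g)
    (hb : ∀ᵐ y, |g y| ≤ 1) : ∫ x, f x * coulPot g x = ∫ x, g x * coulPot f x := by
  simp only [coulPot, ← integral_const_mul]
  rw [integral_integral_swap (integrable_prod_mul_coul hf hg hb)]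
  refine integral_congr_ae (.of_forall fun y => integral_congr_ae (.of_forall fun x => ?_))
  simp only [coul_comm x y]
  ring

/-- The Coulomb kernel truncated at height `1 / (4πδ)`. -/
def truncCoul (δ : ℝ) (x y : E3) : ℝ := 1 / (4 * π * max ‖x - y‖ δ)

theorem continuous_truncCoul {δ : ℝ} (hδ : 0 < δ) (y : E3) :
    Continuous (fun x => truncCoul δ x y) := by
  unfold truncCoul
  refine continuous_const.div (by fun_prop) (fun x => ?_)
  have : 0 < max ‖x - y‖ δ := lt_max_of_lt_right hδ
  positivity

theorem measurable_truncCoul (δ : ℝ) (x : E3) : Measurable (fun y => truncCoul δ x y) := by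
  unfold truncCoul; fun_prop

theorem truncCoul_nonneg {δ : ℝ} (hδ : 0 < δ) (x y : E3) : 0 ≤ truncCoul δ x y := by
  have : 0 < max ‖x - y‖ δ := lt_max_of_lt_right hδ
  unfold truncCoul; positivity

theorem truncCoul_le {δ : ℝ} (hδ : 0 < δ) (x y : E3) : truncCoul δ x y ≤ 1 / (4 * π * δ) := by
  unfold truncCoul
  gcongr
  exact le_max_right _ _

theorem tendsto_truncCoul (δ : ℝ) (y : E3) :
    Tendsto (fun x => truncCoul δ x y) (comap norm atTop) (nhds 0) := by
  unfold truncCoul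
  simp only [one_div]
  refine tendsto_inv_atTop_zero.comp (Tendsto.const_mul_atTop (by positivity) ?_)
  refine tendsto_atTop_mono (fun x => ?_)
    (tendsto_atTop_add_const_right _ (-‖y‖) (tendsto_comap (f := (norm : E3 → ℝ))))
  exact le_trans (by linarith [norm_sub_norm_le x y]) (le_max_left _ _)

/-- The potential of a density for the truncated kernel. -/
def truncPot (δ : ℝ) (f : E3 → ℝ) (x : E3) : ℝ := ∫ y, f y * truncCoul δ x y

theorem norm_mul_truncCoul_le (f : E3 → ℝ) {δ : ℝ} (hδ : 0 < δ) (x y : E3) :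
    ‖f y * truncCoul δ x y‖ ≤ ‖f y‖ * (1 / (4 * π * δ)) := by
  rw [norm_mul, Real.norm_of_nonneg (truncCoul_nonneg hδ x y)]
  exact mul_le_mul_of_nonneg_left (truncCoul_le hδ x y) (norm_nonneg _)

theorem aestronglyMeasurable_mul_truncCoul {f : E3 → ℝ} (hf : Integrable f) (δ : ℝ) (x : E3) :
    AEStronglyMeasurable (fun y => f y * truncCoul δ x y) :=
  hf.aestronglyMeasurable.mul (measurable_truncCoul δ x).aestronglyMeasurable

theorem continuous_truncPot {f : E3 → ℝ} (hf : Integrable f) {δ : ℝ} (hδ : 0 < δ) :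
    Continuous (truncPot δ f) :=
  continuous_of_dominated (aestronglyMeasurable_mul_truncCoul hf δ)
    (fun x => .of_forall fun y => norm_mul_truncCoul_le f hδ x y)
    (hf.norm.mul_const _)
    (.of_forall fun y => continuous_const.mul (continuous_truncCoul hδ y))

theorem tendsto_truncPot {f : E3 → ℝ} (hf : Integrable f) {δ : ℝ} (hδ : 0 < δ) :
    Tendsto (truncPot δ f) (comap norm atTop) (nhds 0) := by
  have h := tendsto_integral_filter_of_dominated_convergence (μ := volume)
    (l := comap (norm : E3 → ℝ) atTop) (F := fun x y => f y * truncCoul δ x y)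
    (f := fun _ => 0) (fun y => ‖f y‖ * (1 / (4 * π * δ)))
    (.of_forall (aestronglyMeasurable_mul_truncCoul hf δ))
    (.of_forall fun x => .of_forall fun y => norm_mul_truncCoul_le f hδ x y)
    (hf.norm.mul_const _)
    (.of_forall fun y => by simpa using (tendsto_truncCoul δ y).const_mul (f y))
  rw [integral_zero] at h
  exact h

theorem abs_coul_sub_truncCoul_le {δ : ℝ} (hδ : 0 < δ) {x y : E3} (h : y ≠ x) :
    |coul x y - truncCoul δ x y| ≤
      (Metric.ball (0 : E3) δ).indicator (fun z => coul z 0) (x - y) := by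
  have hpos : 0 < ‖x - y‖ := norm_pos_iff.2 (sub_ne_zero.2 h.symm)
  by_cases hd : x - y ∈ Metric.ball (0 : E3) δ
  · rw [Set.indicator_of_mem hd, ← coul_eq_sub, abs_le]
    have h1 := truncCoul_nonneg hδ x y
    have h2 : truncCoul δ x y ≤ coul x y := by
      unfold truncCoul coul
      gcongr
      exact le_max_left _ _
    constructor <;> linarith
  · rw [Set.indicator_of_notMem hd]
    have h1 : δ ≤ ‖x - y‖ := by simpa using hd
    simp [coul, truncCoul, max_eq_left h1]

theorem abs_coulPot_sub_truncPot_le {f : E3 → ℝ} (hf : Integrable f) (hb : ∀ᵐ y, |f y| ≤ 1)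
    {δ : ℝ} (hδ : 0 < δ) (x : E3) : |coulPot f x - truncPot δ f x| ≤ coulBallMass δ := by
  have hi : Integrable (fun y => f y * truncCoul δ x y) :=
    (hf.norm.mul_const (1 / (4 * π * δ))).mono' (aestronglyMeasurable_mul_truncCoul hf δ x)
      (.of_forall fun y => norm_mul_truncCoul_le f hδ x y)
  rw [coulPot, truncPot, ← integral_sub (integrable_mul_coul hf hb x) hi, coulBallMass,
    ← integral_sub_left_eq_self ((Metric.ball (0 : E3) δ).indicator _) volume x, ← Real.norm_eq_abs]
  refine norm_integral_le_of_norm_le ((integrable_indicator_coul δ).comp_sub_left x) ?_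
  filter_upwards [hb, compl_mem_ae_iff.2 (measure_singleton x)] with y hy hyx
  rw [← mul_sub, norm_mul, Real.norm_eq_abs, Real.norm_eq_abs]
  have h1 := abs_coul_sub_truncCoul_le hδ (show y ≠ x from hyx)
  nlinarith [abs_nonneg (coul x y - truncCoul δ x y), abs_nonneg (f y)]

theorem tendstoUniformly_truncPot {f : E3 → ℝ} (hf : Integrable f) (hb : ∀ᵐ y, |f y| ≤ 1) :
    TendstoUniformly (fun n : ℕ => truncPot (1 / ((n : ℝ) + 1)) f) (coulPot f) atTop := by
  rw [Metric.tendstoUniformly_iff]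
  intro ε hε
  filter_upwards [tendsto_coulBallMass.eventually (gt_mem_nhds hε)] with n hn x
  exact (abs_coulPot_sub_truncPot_le hf hb Nat.one_div_pos_of_nat x).trans_lt hn

theorem continuous_coulPot {f : E3 → ℝ} (hf : Integrable f) (hb : ∀ᵐ y, |f y| ≤ 1) :
    Continuous (coulPot f) :=
  (tendstoUniformly_truncPot hf hb).continuous
    (.of_forall fun _ => continuous_truncPot hf Nat.one_div_pos_of_nat)

theorem tendsto_coulPot_cocompact {f : E3 → ℝ} (hf : Integrable f) (hb : ∀ᵐ y, |f y| ≤ 1) :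
    Tendsto (coulPot f) (cocompact E3) (nhds 0) := by
  rw [← Metric.cobounded_eq_cocompact, ← comap_norm_atTop]
  exact (tendstoUniformly_truncPot hf hb).tendsto_of_eventually_tendsto
    (.of_forall fun _ => tendsto_truncPot hf Nat.one_div_pos_of_nat) tendsto_const_nhds

theorem abs_indicator_one_le (s : Set E3) : ∀ᵐ y, |s.indicator (fun _ => (1 : ℝ)) y| ≤ 1 :=
  .of_forall fun y => by
    by_cases h : y ∈ s <;> simp [h]

theorem integrable_indicator_ball (c : E3) (r : ℝ) :
    Integrable ((Metric.ball c r).indicator (fun _ => (1 : ℝ))) :=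
  (integrable_indicator_iff measurableSet_ball).2 (integrableOn_const measure_ball_lt_top.ne)

/-- The splitting of three-dimensional space into the first axis and the orthogonal plane. -/
def axisPlane : E3 ≃ᵐ ℝ × EuclideanSpace ℝ (Fin 2) :=
  (MeasurableEquiv.toLp 2 (Fin 3 → ℝ)).symm.trans
    ((MeasurableEquiv.piFinSuccAbove (fun _ => ℝ) 0).trans
      (MeasurableEquiv.prodCongr (MeasurableEquiv.refl ℝ) (MeasurableEquiv.toLp 2 (Fin 2 → ℝ))))

theorem measurePreserving_axisPlane : MeasurePreserving axisPlane := by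
  refine MeasurePreserving.trans (EuclideanSpace.volume_preserving_symm_measurableEquiv_toLp _) ?_
  refine MeasurePreserving.trans (volume_preserving_piFinSuccAbove (fun _ => ℝ) 0) ?_
  exact (MeasurePreserving.id volume).prod (PiLp.volume_preserving_toLp (Fin 2))

theorem norm_sub_single_eq (a : ℝ) (x : E3) :
    ‖EuclideanSpace.single 0 a - x‖ =
      √(((axisPlane x).1 - a) ^ 2 + ‖(axisPlane x).2‖ ^ 2) := by
  rw [EuclideanSpace.norm_eq, EuclideanSpace.norm_sq_eq]
  have h0 : (axisPlane x).1 = x 0 := rfl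
  have h1 : (axisPlane x).2 0 = x 1 := rfl
  have h2 : (axisPlane x).2 1 = x 2 := rfl
  simp only [Fin.sum_univ_two, Fin.sum_univ_three, h0, h1, h2, PiLp.sub_apply]
  simp
  ring_nf

theorem integral_radial_disc {c R : ℝ} (hc : c ≠ 0) (hR : 0 ≤ R) :
    ∫ p : EuclideanSpace ℝ (Fin 2), (Metric.ball (0 : EuclideanSpace ℝ (Fin 2)) R).indicator
      (fun p => 1 / √(c ^ 2 + ‖p‖ ^ 2)) p = 2 * π * (√(c ^ 2 + R ^ 2) - |c|) := by
  have h : ((Metric.ball (0 : EuclideanSpace ℝ (Fin 2)) R).indicator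
      (fun p => 1 / √(c ^ 2 + ‖p‖ ^ 2)))
      = fun p => (fun s : ℝ => (Set.Iio R).indicator (fun s => 1 / √(c ^ 2 + s ^ 2)) s) ‖p‖ := by
    funext z
    simp [Set.indicator]
  have hpos : ∀ s : ℝ, 0 < c ^ 2 + s ^ 2 := fun s => by positivity
  have hcont : Continuous (fun s : ℝ => s / √(c ^ 2 + s ^ 2)) :=
    continuous_id.div (by fun_prop) (fun s => (Real.sqrt_pos.2 (hpos s)).ne')
  have hint : ∫ s in (0 : ℝ)..R, s / √(c ^ 2 + s ^ 2) = √(c ^ 2 + R ^ 2) - |c| := by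
    rw [intervalIntegral.integral_eq_sub_of_hasDerivAt (f := fun s => √(c ^ 2 + s ^ 2))
      (fun s _ => ?_) (hcont.intervalIntegrable _ _)]
    · simp [Real.sqrt_sq_eq_abs]
    · refine (((hasDerivAt_pow 2 s).const_add (c ^ 2)).sqrt (hpos s).ne').congr_deriv ?_
      field_simp
      norm_num
  rw [h, integral_fun_norm_addHaar]
  have h2 : ∫ s in Set.Ioi (0 : ℝ), s ^ (Module.finrank ℝ (EuclideanSpace ℝ (Fin 2)) - 1) •
      (Set.Iio R).indicator (fun s => 1 / √(c ^ 2 + s ^ 2)) s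
      = √(c ^ 2 + R ^ 2) - |c| := by
    rw [← hint, intervalIntegral.integral_of_le hR, integral_Ioc_eq_integral_Ioo,
      ← integral_indicator measurableSet_Ioo, ← integral_indicator measurableSet_Ioi]
    congr 1
    funext s
    by_cases h0 : 0 < s <;> by_cases h1 : s < R <;> simp [Set.indicator, h0, h1, div_eq_mul_inv]
  rw [h2]
  simp [Measure.real, ENNReal.toReal_ofReal pi_nonneg]
  ring

theorem integral_sqrt_affine {a r : ℝ} (ha : 0 < a) (hr : 0 ≤ r) :
    ∫ z in (-r)..r, √(r ^ 2 + a ^ 2 - 2 * a * z) = ((r + a) ^ 3 - |r - a| ^ 3) / (3 * a) := by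
  have hcube : ∀ b : ℝ, 0 ≤ b → (b ^ 2) ^ (3 / 2 : ℝ) = b ^ 3 := by
    intro b hb
    rw [← Real.rpow_natCast, ← Real.rpow_mul hb, ← Real.rpow_natCast]
    norm_num
  rw [intervalIntegral.integral_eq_sub_of_hasDerivAt
    (f := fun z => -(r ^ 2 + a ^ 2 - 2 * a * z) ^ (3 / 2 : ℝ) / (3 * a)) (fun z _ => ?_)
    (Continuous.intervalIntegrable (by fun_prop) _ _)]
  · have h1 : r ^ 2 + a ^ 2 - 2 * a * r = |r - a| ^ 2 := by rw [sq_abs]; ring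
    have h2 : r ^ 2 + a ^ 2 - 2 * a * -r = (r + a) ^ 2 := by ring
    simp only [h1, h2]
    rw [hcube _ (abs_nonneg _), hcube _ (by positivity)]
    ring
  · have hd : HasDerivAt (fun z : ℝ => r ^ 2 + a ^ 2 - 2 * a * z) (-(2 * a)) z := by
      simpa using ((hasDerivAt_id z).const_mul (2 * a)).const_sub (r ^ 2 + a ^ 2)
    refine ((hd.rpow_const (p := 3 / 2)
      (Or.inr (by norm_num))).neg.div_const (3 * a)).congr_deriv ?_
    rw [Real.sqrt_eq_rpow]
    field_simp
    norm_num

theorem integral_abs_sub_of_le {a r : ℝ} (hr : 0 ≤ r) (h : r ≤ a) :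
    ∫ z in (-r)..r, |z - a| = 2 * a * r := by
  have : ∫ z in (-r)..r, |z - a| = ∫ z in (-r)..r, (a - z) := by
    refine intervalIntegral.integral_congr fun z hz => ?_
    rw [Set.uIcc_of_le (by linarith)] at hz
    rw [abs_of_nonpos (by linarith [hz.2])]
    ring
  rw [this, intervalIntegral.integral_sub (Continuous.intervalIntegrable (by fun_prop) _ _)
    (Continuous.intervalIntegrable (by fun_prop) _ _)]
  simp
  ring

theorem integral_abs_sub_of_ge {a r : ℝ} (ha : 0 ≤ a) (h : a ≤ r) :
    ∫ z in (-r)..r, |z - a| = r ^ 2 + a ^ 2 := by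
  have hc : Continuous fun z : ℝ => |z - a| := by fun_prop
  rw [← intervalIntegral.integral_add_adjacent_intervals (hc.intervalIntegrable (-r) a)
    (hc.intervalIntegrable a r)]
  have h1 : ∫ z in (-r)..a, |z - a| = ∫ z in (-r)..a, (a - z) := by
    refine intervalIntegral.integral_congr fun z hz => ?_
    rw [Set.uIcc_of_le (by linarith)] at hz
    rw [abs_of_nonpos (by linarith [hz.2])]
    ring
  have h2 : ∫ z in a..r, |z - a| = ∫ z in a..r, (z - a) := by
    refine intervalIntegral.integral_congr fun z hz => ?_
    rw [Set.uIcc_of_le (by linarith)] at hz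
    rw [abs_of_nonneg (by linarith [hz.1])]
  rw [h1, h2, intervalIntegral.integral_sub (Continuous.intervalIntegrable (by fun_prop) _ _)
    (Continuous.intervalIntegrable (by fun_prop) _ _)]
  simp
  ring

theorem coulPot_ball_single {a r : ℝ} (hr : 0 < r) :
    coulPot ((Metric.ball (0 : E3) r).indicator (fun _ => 1)) (EuclideanSpace.single 0 a) =
      1 / 2 * ∫ z in (-r)..r, (√(r ^ 2 + a ^ 2 - 2 * a * z) - |z - a|) := by
  set F : ℝ × EuclideanSpace ℝ (Fin 2) → ℝ := fun q =>
    {q : ℝ × EuclideanSpace ℝ (Fin 2) | q.1 ^ 2 + ‖q.2‖ ^ 2 < r ^ 2}.indicator (fun _ => 1) q *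
      (1 / (4 * π * √((q.1 - a) ^ 2 + ‖q.2‖ ^ 2))) with hF
  have hFe : ∀ x : E3, (Metric.ball (0 : E3) r).indicator (fun _ => (1 : ℝ)) x *
      coul (EuclideanSpace.single 0 a) x = F (axisPlane x) := by
    intro x
    have h0 := norm_sub_single_eq 0 x
    rw [show (EuclideanSpace.single 0 0 : E3) = 0 by ext i; simp, zero_sub, norm_neg, sub_zero] at h0
    have h1 : x ∈ Metric.ball (0 : E3) r ↔ (axisPlane x).1 ^ 2 + ‖(axisPlane x).2‖ ^ 2 < r ^ 2 := by
      rw [mem_ball_zero_iff, h0, Real.sqrt_lt' hr]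
    simp only [hF, coul, norm_sub_single_eq, Set.indicator, h1, Set.mem_ofPred_eq]
  have hI : Integrable F (volume.prod volume) := by
    refine (measurePreserving_axisPlane.integrable_comp_emb
      axisPlane.measurableEmbedding).1 ?_
    exact (integrable_mul_coul (integrable_indicator_ball 0 r) (abs_indicator_one_le _)
      (EuclideanSpace.single 0 a)).congr (.of_forall hFe)
  have hslice : ∀ z : ℝ, z ≠ a → ∫ p, F (z, p) = (Set.Ioo (-r) r).indicator
      (fun z => 1 / 2 * (√(r ^ 2 + a ^ 2 - 2 * a * z) - |z - a|)) z := by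
    intro z hz
    by_cases hzr : z ∈ Set.Ioo (-r) r
    · have hz2 : 0 < r ^ 2 - z ^ 2 := by nlinarith [hzr.1, hzr.2]
      have h1 : (fun p => F (z, p)) = fun p => 1 / (4 * π) *
          (Metric.ball (0 : EuclideanSpace ℝ (Fin 2)) √(r ^ 2 - z ^ 2)).indicator
            (fun p => 1 / √((z - a) ^ 2 + ‖p‖ ^ 2)) p := by
        funext p
        have h2 : p ∈ Metric.ball (0 : EuclideanSpace ℝ (Fin 2)) √(r ^ 2 - z ^ 2) ↔
            z ^ 2 + ‖p‖ ^ 2 < r ^ 2 := by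
          rw [mem_ball_zero_iff, Real.lt_sqrt (norm_nonneg p)]
          constructor <;> intro h <;> linarith
        simp only [hF, Set.indicator, h2, Set.mem_ofPred_eq]
        split_ifs
        · rw [one_mul, one_div_mul_one_div]
        · simp
      rw [h1, integral_const_mul, integral_radial_disc (sub_ne_zero.2 hz) (Real.sqrt_nonneg _),
        Real.sq_sqrt hz2.le, Set.indicator_of_mem hzr,
        show (z - a) ^ 2 + (r ^ 2 - z ^ 2) = r ^ 2 + a ^ 2 - 2 * a * z by ring]
      field_simp
      norm_num
    · have hz2 : r ^ 2 ≤ z ^ 2 := by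
        rw [← sq_abs z, sq_le_sq₀ hr.le (abs_nonneg z)]
        by_contra hlt
        exact hzr (abs_lt.1 (not_le.1 hlt))
      rw [Set.indicator_of_notMem hzr]
      have h1 : (fun p => F (z, p)) = fun _ => 0 := by
        funext p
        have : ¬ z ^ 2 + ‖p‖ ^ 2 < r ^ 2 := by nlinarith [norm_nonneg p]
        simp [hF, this]
      rw [h1, integral_zero]
  rw [coulPot, integral_congr_ae (.of_forall hFe),
    measurePreserving_axisPlane.integral_comp' F, Measure.volume_eq_prod, integral_prod F hI,
    ← intervalIntegral.integral_const_mul, intervalIntegral.integral_of_le (by linarith),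
    integral_Ioc_eq_integral_Ioo, ← integral_indicator measurableSet_Ioo]
  refine integral_congr_ae ?_
  filter_upwards [compl_mem_ae_iff.2 (measure_singleton a)] with z hz
  exact hslice z hz

theorem coulPot_ball_single_eq {a r : ℝ} (hr : 0 < r) (h : r ≤ a) :
    coulPot ((Metric.ball (0 : E3) r).indicator (fun _ => 1)) (EuclideanSpace.single 0 a) =
      r ^ 3 / (3 * a) := by
  have ha : 0 < a := hr.trans_le h
  rw [coulPot_ball_single hr, intervalIntegral.integral_sub
    (Continuous.intervalIntegrable (by fun_prop) _ _)
    (Continuous.intervalIntegrable (by fun_prop) _ _),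
    integral_sqrt_affine ha hr.le, integral_abs_sub_of_le hr.le h, abs_of_nonpos (by linarith)]
  field_simp
  ring

theorem coulPot_ball_single_le {a r : ℝ} (hr : 0 < r) (ha : 0 < a) :
    coulPot ((Metric.ball (0 : E3) r).indicator (fun _ => 1)) (EuclideanSpace.single 0 a) ≤
      r ^ 3 / (3 * a) := by
  rcases le_total r a with h | h
  · exact (coulPot_ball_single_eq hr h).le
  rw [coulPot_ball_single hr, intervalIntegral.integral_sub
    (Continuous.intervalIntegrable (by fun_prop) _ _)
    (Continuous.intervalIntegrable (by fun_prop) _ _),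
    integral_sqrt_affine ha hr.le, integral_abs_sub_of_ge ha.le h, abs_of_nonneg (by linarith)]
  rw [← sub_nonneg]
  have : r ^ 3 / (3 * a) - 1 / 2 * (((r + a) ^ 3 - (r - a) ^ 3) / (3 * a) - (r ^ 2 + a ^ 2))
      = (r - a) ^ 2 * (2 * r + a) / (6 * a) := by
    field_simp
    ring
  rw [this]
  positivity

theorem coulPot_ball_eq_single (c y : E3) (r : ℝ) :
    coulPot ((Metric.ball c r).indicator (fun _ => 1)) y =
      coulPot ((Metric.ball (0 : E3) r).indicator (fun _ => 1))
        (EuclideanSpace.single 0 ‖y - c‖) := by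
  have hn : ‖y - c‖ = ‖(EuclideanSpace.single 0 ‖y - c‖ : E3)‖ := by simp
  set L := (Submodule.span ℝ {y - c - EuclideanSpace.single 0 ‖y - c‖})ᗮ.reflection with hL
  have hLy : L (y - c) = EuclideanSpace.single 0 ‖y - c‖ := Submodule.reflection_sub hn
  rw [← hLy, coulPot, coulPot, ← integral_add_right_eq_self
    (fun x => (Metric.ball c r).indicator (fun _ => (1 : ℝ)) x * coul y x) c,
    ← L.measurePreserving.integral_comp L.toHomeomorph.measurableEmbedding
      (fun x => (Metric.ball 0 r).indicator (fun _ => (1 : ℝ)) x * coul (L (y - c)) x)]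
  refine integral_congr_ae (.of_forall fun x => ?_)
  simp only [Set.indicator, Metric.mem_ball, dist_eq_norm, add_sub_cancel_right, sub_zero,
    coul, ← map_sub, LinearIsometryEquiv.norm_map]
  rw [show y - (x + c) = y - c - x by abel]

/-- The potential of a uniformly charged ball, outside the ball, is that of its centre. -/
theorem coulPot_ball_eq {c y : E3} {r : ℝ} (hr : 0 < r) (h : r ≤ ‖y - c‖) :
    coulPot ((Metric.ball c r).indicator (fun _ => 1)) y = 4 * π * r ^ 3 / 3 * coul c y := by
  have : 0 < ‖y - c‖ := hr.trans_le h
  rw [coulPot_ball_eq_single, coulPot_ball_single_eq hr h, coul, norm_sub_rev c y]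
  field_simp

/-- The potential of a uniformly charged ball is at most that of the same charge at its centre. -/
theorem coulPot_ball_le {c y : E3} {r : ℝ} (hr : 0 < r) (h : y ≠ c) :
    coulPot ((Metric.ball c r).indicator (fun _ => 1)) y ≤ 4 * π * r ^ 3 / 3 * coul c y := by
  have h0 : 0 < ‖y - c‖ := norm_pos_iff.2 (sub_ne_zero.2 h)
  rw [coulPot_ball_eq_single]
  refine (coulPot_ball_single_le hr h0).trans_eq ?_
  rw [coul, norm_sub_rev c y]
  field_simp

/-- The potential is superharmonic where the density is nonnegative. -/
theorem setIntegral_coulPot_le {f : E3 → ℝ} (hf : Integrable f) (hb : ∀ᵐ y, |f y| ≤ 1)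
    {c : E3} {r : ℝ} (hr : 0 < r) (hpos : ∀ᵐ y, y ∈ Metric.ball c r → 0 ≤ f y) :
    ∫ x in Metric.ball c r, coulPot f x ≤ 4 * π * r ^ 3 / 3 * coulPot f c := by
  have h1 : ∫ x in Metric.ball c r, coulPot f x =
      ∫ x, (Metric.ball c r).indicator (fun _ => (1 : ℝ)) x * coulPot f x := by
    rw [← integral_indicator measurableSet_ball]
    congr 1
    funext x
    by_cases hx : x ∈ Metric.ball c r <;> simp [Set.indicator, hx]
  rw [h1, integral_mul_coulPot_comm (integrable_indicator_ball c r) hf hb]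
  rw [show coulPot f c = ∫ y, f y * coul c y from rfl, ← integral_const_mul]
  refine integral_mono_ae (integrable_mul_coulPot hf (integrable_indicator_ball c r)
    (abs_indicator_one_le _)) ((integrable_mul_coul hf hb c).const_mul _) ?_
  filter_upwards [hpos, compl_mem_ae_iff.2 (measure_singleton c)] with y hy hyc
  have hyc' : y ≠ c := hyc
  by_cases hyb : y ∈ Metric.ball c r
  · have := mul_le_mul_of_nonneg_left (coulPot_ball_le hr hyc') (hy hyb)
    linarith
  · have h2 : r ≤ ‖y - c‖ := by simpa [dist_eq_norm] using hyb
    rw [coulPot_ball_eq hr h2]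
    linarith

/-- Minimum principle: a potential whose density is nonnegative where the potential is negative
is nonnegative. -/
theorem coulPot_nonneg_of_ae_nonneg {f : E3 → ℝ} (hf : Integrable f) (hb : ∀ᵐ y, |f y| ≤ 1)
    (hpos : ∀ᵐ y, coulPot f y < 0 → 0 ≤ f y) (x : E3) : 0 ≤ coulPot f x := by
  by_contra! hx
  have hc := continuous_coulPot hf hb
  have ht := tendsto_coulPot_cocompact hf hb
  obtain ⟨x₀, hx₀⟩ := hc.exists_forall_le' x
    ((ht.eventually (lt_mem_nhds hx)).mono fun _ h => h.le)
  have hneg : coulPot f x₀ < 0 := (hx₀ x).trans_lt hx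
  have hopen : IsOpen {z | coulPot f z = coulPot f x₀} := by
    rw [Metric.isOpen_iff]
    intro z hz
    have hz' : coulPot f z = coulPot f x₀ := hz
    obtain ⟨r, hr, hball⟩ := Metric.isOpen_iff.1 (isOpen_lt hc continuous_const) z
      (show coulPot f z < 0 by rw [hz']; exact hneg)
    refine ⟨r, hr, ?_⟩
    have hle := setIntegral_coulPot_le hf hb hr (hpos.mono fun y hy hyb => hy (hball hyb))
    have hci : IntegrableOn (coulPot f) (Metric.ball z r) :=
      (hc.continuousOn.integrableOn_compact (isCompact_closedBall z r)).mono_set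
        Metric.ball_subset_closedBall
    have hk : IntegrableOn (fun _ : E3 => coulPot f x₀) (Metric.ball z r) :=
      integrableOn_const measure_ball_lt_top.ne
    have hvol : ∫ _ in Metric.ball z r, coulPot f x₀ = 4 * π * r ^ 3 / 3 * coulPot f x₀ := by
      rw [setIntegral_const, Measure.real, EuclideanSpace.volume_ball_fin_three]
      rw [ENNReal.toReal_mul, ENNReal.toReal_pow, ENNReal.toReal_ofReal hr.le,
        ENNReal.toReal_ofReal (by positivity), smul_eq_mul]
      ring
    have hzero : ∫ y in Metric.ball z r, (coulPot f y - coulPot f x₀) = 0 := by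
      refine le_antisymm ?_ (integral_nonneg fun y => sub_nonneg.2 (hx₀ y))
      rw [integral_sub hci hk, hvol]
      rw [hz'] at hle
      linarith
    rw [integral_eq_zero_iff_of_nonneg (fun y => sub_nonneg.2 (hx₀ y)) (hci.sub hk)] at hzero
    have heq := Measure.eqOn_open_of_ae_eq hzero Metric.isOpen_ball
      (hc.sub continuous_const).continuousOn continuousOn_const
    exact fun y hy => sub_eq_zero.1 (heq hy)
  have huniv := IsClopen.eq_univ ⟨isClosed_eq hc continuous_const, hopen⟩ ⟨x₀, rfl⟩
  have hlim : Tendsto (coulPot f) (cocompact E3) (nhds (coulPot f x₀)) :=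
    tendsto_const_nhds.congr fun y => (show y ∈ {z | coulPot f z = coulPot f x₀} by
      rw [huniv]; trivial : coulPot f y = coulPot f x₀).symm
  exact hneg.ne (tendsto_nhds_unique hlim ht)

theorem coulPot_add_const_mul {f g : E3 → ℝ} (hf : Integrable f) (hg : Integrable g)
    (hfb : ∀ᵐ y, |f y| ≤ 1) (hgb : ∀ᵐ y, |g y| ≤ 1) (t : ℝ) (x : E3) :
    coulPot (fun y => f y + t * g y) x = coulPot f x + t * coulPot g x := by
  simp only [coulPot]
  rw [← integral_const_mul, ← integral_add (integrable_mul_coul hf hfb x)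
    ((integrable_mul_coul hg hgb x).const_mul t)]
  congr 1
  funext y
  ring

/-- Expansion of the Coulomb energy along a perturbation of the density. -/
theorem integral_mul_coulPot_add_const_mul {f g : E3 → ℝ} (hf : Integrable f) (hg : Integrable g)
    (hfb : ∀ᵐ y, |f y| ≤ 1) (hgb : ∀ᵐ y, |g y| ≤ 1) (t : ℝ) :
    ∫ x, (f x + t * g x) * coulPot (fun y => f y + t * g y) x =
      (∫ x, f x * coulPot f x) + 2 * t * (∫ x, g x * coulPot f x)
        + t ^ 2 * (∫ x, g x * coulPot g x) := by
  have hff := integrable_mul_coulPot hf hf hfb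
  have hfg := integrable_mul_coulPot hf hg hgb
  have hgf := integrable_mul_coulPot hg hf hfb
  have hgg := integrable_mul_coulPot hg hg hgb
  have h : ∀ x, (f x + t * g x) * coulPot (fun y => f y + t * g y) x =
      f x * coulPot f x + t * (f x * coulPot g x) + t * (g x * coulPot f x)
        + t ^ 2 * (g x * coulPot g x) := by
    intro x
    rw [coulPot_add_const_mul hf hg hfb hgb]
    ring
  rw [integral_congr_ae (.of_forall h)]
  have h1 := hff.add (hfg.const_mul t)
  have h2 := h1.add (hgf.const_mul t)
  simp only [Pi.add_def] at h1 h2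
  rw [integral_add h2 (hgg.const_mul _), integral_add h1 (hgf.const_mul t),
    integral_add hff (hfg.const_mul t), integral_const_mul, integral_const_mul,
    integral_const_mul, integral_mul_coulPot_comm hf hg hgb]
  ring

theorem nonneg_of_forall_quadratic_nonneg {b c : ℝ}
    (h : ∀ t : ℝ, 0 < t → t ≤ 1 → 0 ≤ 2 * t * b + t ^ 2 * c) : 0 ≤ b := by
  by_contra! hb
  have hden : 0 < |c| - b := by linarith [abs_nonneg c]
  have ht : 0 < -b / (|c| - b) := div_pos (by linarith) hden
  have ht1 : -b / (|c| - b) ≤ 1 := (div_le_one hden).2 (by linarith [abs_nonneg c])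
  have h1 := h _ ht ht1
  have h2 : -b / (|c| - b) * |c| ≤ -b := by
    rw [div_mul_eq_mul_div, div_le_iff₀ hden]
    nlinarith [abs_nonneg c]
  have h3 : -b / (|c| - b) * c ≤ -b :=
    (mul_le_mul_of_nonneg_left (le_abs_self c) ht.le).trans h2
  nlinarith

theorem relEnergy_eq (Ωp : Set E3) (u : E3 → ℝ) :
    relEnergy Ωp u = ∫ x, (Set.indicator Ωp (fun _ => (1 : ℝ)) x - u x) *
      coulPot (fun y => Set.indicator Ωp (fun _ => (1 : ℝ)) y - u y) x := by
  simp only [relEnergy, coulPot, integral_const_mul]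

/-- **Lemma 3.4** (Nonnegativity of the potential): the potential of the
minimizer of the relaxed problem is everywhere nonnegative. -/
theorem relaxed_minimizer_potential_nonneg
    (Ωp : Set E3) (ho : IsOpen Ωp) (hb : Bornology.IsBounded Ωp)
    (m : ℝ) (hm : 0 < m) (hvol : volume Ωp = ENNReal.ofReal m)
    (lam : ℝ) (hlam : 0 < lam)
    (u : E3 → ℝ) (hadm : RelAdm Ωp lam u)
    (hmin : ∀ v, RelAdm Ωp lam v → relEnergy Ωp u ≤ relEnergy Ωp v) :
    ∀ x, 0 ≤ potentialU Ωp u x := by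
  obtain ⟨hu, hu01, huΩ, hulam⟩ := hadm
  set ρ : E3 → ℝ := fun y => Set.indicator Ωp (fun _ => (1 : ℝ)) y - u y with hρ
  have hρi : Integrable ρ :=
    ((integrable_indicator_iff ho.measurableSet).2
      (integrableOn_const (by rw [hvol]; exact ENNReal.ofReal_ne_top))).sub hu
  have hρb : ∀ᵐ y, |ρ y| ≤ 1 := by
    filter_upwards [hu01] with y hy
    by_cases h : y ∈ Ωp <;> simp only [hρ, h, Set.indicator_of_mem, Set.indicator_of_notMem,
      not_false_eq_true, abs_le] <;> constructor <;> linarith [hy.1, hy.2]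
  have hN : MeasurableSet {x | coulPot ρ x < 0} :=
    (isOpen_lt (continuous_coulPot hρi hρb) continuous_const).measurableSet
  set w : E3 → ℝ := {x | coulPot ρ x < 0}.indicator u with hw
  have hwi : Integrable w := hu.indicator hN
  have hw01 : ∀ᵐ y, 0 ≤ w y ∧ w y ≤ u y ∧ u y ≤ 1 := by
    filter_upwards [hu01] with y hy
    by_cases h : coulPot ρ y < 0 <;> simp [hw, h, hy.1, hy.2]
  have hwb : ∀ᵐ y, |w y| ≤ 1 := by
    filter_upwards [hw01] with y hy
    rw [abs_of_nonneg hy.1]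
    exact hy.2.1.trans hy.2.2
  have hfirst : 0 ≤ ∫ x, w x * coulPot ρ x := by
    refine nonneg_of_forall_quadratic_nonneg (c := ∫ x, w x * coulPot w x) fun t ht0 ht1 => ?_
    have hv : RelAdm Ωp lam (fun x => u x - t * w x) := by
      refine ⟨hu.sub (hwi.const_mul t), ?_, ?_, le_trans ?_ hulam⟩
      · filter_upwards [hw01] with y hy
        constructor <;> nlinarith [hy.1, hy.2.1, hy.2.2]
      · filter_upwards [huΩ] with y hy hyΩ
        simp [hw, Set.indicator_apply, hy hyΩ]
      · refine integral_mono_ae (hu.sub (hwi.const_mul t)) hu ?_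
        filter_upwards [hw01] with y hy
        nlinarith [hy.1]
    have h1 := hmin _ hv
    have h2 : (fun y => Set.indicator Ωp (fun _ => (1 : ℝ)) y - (u y - t * w y)) =
        fun y => ρ y + t * w y := by
      funext y
      simp only [hρ]
      ring
    rw [relEnergy_eq, relEnergy_eq, h2] at h1
    simp only [fun y => congrFun h2 y] at h1
    rw [integral_mul_coulPot_add_const_mul hρi hwi hρb hwb] at h1
    linarith
  have hnonpos : ∀ᵐ x, 0 ≤ -(w x * coulPot ρ x) := by
    filter_upwards [hw01] with x hx
    by_cases h : coulPot ρ x < 0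
    · nlinarith [hx.1]
    · simp [hw, h]
  have hzero : ∫ x, -(w x * coulPot ρ x) = 0 := by
    refine le_antisymm ?_ (integral_nonneg_of_ae hnonpos)
    rw [integral_neg]
    linarith
  rw [integral_eq_zero_iff_of_nonneg_ae hnonpos (integrable_mul_coulPot hwi hρi hρb).neg] at hzero
  refine coulPot_nonneg_of_ae_nonneg hρi hρb ?_
  filter_upwards [hzero] with y hy hneg
  have hwy : w y = u y := Set.indicator_of_mem (s := {x | coulPot ρ x < 0}) hneg u
  have hy' : u y * coulPot ρ y = 0 := by
    rw [← hwy]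
    exact neg_eq_zero.1 hy
  have huy : u y = 0 := (mul_eq_zero.1 hy').resolve_right hneg.ne
  rw [huy, sub_zero]
  exact Set.indicator_nonneg (fun _ _ => zero_le_one) y
end
end
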